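/- arXiv:2508.15520 — 2 statements merged into one kernel-verified Lean document; each statement's English description precedes it below -/
import Mathlib

section
/- Assume that for all configurations G_in, G_tar ∈ 𝒞, every flip sequence from G_in to G_tar that flips a happy edge has length at least dist(G_in, G_tar) + 2. Then the perfect flip property holds: for all G_0, G_1, G_tar ∈ 𝒞 such that Flip G_0 G_1, |G_1 ∩ G_tar| = |G_0 ∩ G_tar| + 1, and some flip sequence from G_1 to G_tar exists, one has dist(G_0, G_tar) = dist(G_1, G_tar) + 1 (so some shortest flip sequence from G_0 to G_tar begins with the flip from G_0 to G_1). -/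
namespace FlipAbstract

/-- A flip sequence of length `k` from `G` to `H` within the set of
configurations `C`, for the flip relation `Flip`. -/
def FSeq {E : Type*} (C : Set (Finset E)) (Flip : Finset E → Finset E → Prop)
    (seq : ℕ → Finset E) (k : ℕ) (G H : Finset E) : Prop :=
  seq 0 = G ∧ seq k = H ∧ (∀ i ≤ k, seq i ∈ C) ∧ ∀ i < k, Flip (seq i) (seq (i + 1))

/-- The flip distance: the minimum length of a flip sequence from `G` to `H`. -/
noncomputable def fdist {E : Type*} (C : Set (Finset E))
    (Flip : Finset E → Finset E → Prop) (G H : Finset E) : ℕ :=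
  sInf {k | ∃ seq, FSeq C Flip seq k G H}

/-- Prepending a flip to a flip sequence gives a flip sequence. -/
theorem FSeq.cons {E : Type*} {C : Set (Finset E)} {Flip : Finset E → Finset E → Prop}
    {seq : ℕ → Finset E} {k : ℕ} {F G H : Finset E} (h : FSeq C Flip seq k G H)
    (hF : F ∈ C) (hFG : Flip F G) :
    FSeq C Flip (fun n => Nat.casesOn n F seq) (k + 1) F H := by
  obtain ⟨h0, hk, hC, hs⟩ := h
  refine ⟨rfl, hk, ?_, ?_⟩
  · rintro (_ | i) hi
    · exact hF
    · exact hC i (by omega)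
  · rintro (_ | i) hi
    · simpa [h0] using hFG
    · exact hs i (by omega)

/-- The flip distance is attained by some flip sequence, if there is any. -/
theorem exists_fSeq_fdist {E : Type*} {C : Set (Finset E)} {Flip : Finset E → Finset E → Prop}
    {G H : Finset E} (h : ∃ seq k, FSeq C Flip seq k G H) :
    ∃ seq, FSeq C Flip seq (fdist C Flip G H) G H := by
  obtain ⟨seq, k, h⟩ := h
  exact Nat.sInf_mem (s := {k | ∃ seq, FSeq C Flip seq k G H}) ⟨k, seq, h⟩

/-- If every flip sequence that flips a happy edge can be shortened by at least
two flips (i.e. has length at least `dist + 2`), then the perfect flip property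
holds: any flip that increases the number of edges in common with the target by
one starts some shortest flip sequence. -/
theorem statement_9 {E : Type*} [DecidableEq E]
    (C : Set (Finset E)) (Flip : Finset E → Finset E → Prop)
    (hsymm : ∀ G H, Flip G H → Flip H G)
    (hstruct : ∀ G H, Flip G H →
      G ∈ C ∧ H ∈ C ∧ ∃ e ∈ G, ∃ f, f ∉ G ∧ H = insert f (G.erase e))
    (hhappy : ∀ (Gin Gtar : Finset E) (seq : ℕ → Finset E) (k : ℕ),
      FSeq C Flip seq k Gin Gtar →
      (∃ i < k, ∃ e, e ∈ Gin ∩ Gtar ∧ e ∈ seq i ∧ e ∉ seq (i + 1)) →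
      fdist C Flip Gin Gtar + 2 ≤ k) :
    ∀ G₀ G₁ Gtar : Finset E, G₀ ∈ C → G₁ ∈ C → Gtar ∈ C →
      Flip G₀ G₁ → (G₁ ∩ Gtar).card = (G₀ ∩ Gtar).card + 1 →
      (∃ seq k, FSeq C Flip seq k G₁ Gtar) →
      fdist C Flip G₀ Gtar = fdist C Flip G₁ Gtar + 1 := by
  intro G₀ G₁ Gtar h₀ h₁ _ hflip hcard hreach
  obtain ⟨s₁, hs₁⟩ := exists_fSeq_fdist hreach
  have hcons := hs₁.cons h₀ hflip
  have hle : fdist C Flip G₀ Gtar ≤ fdist C Flip G₁ Gtar + 1 := Nat.sInf_le ⟨_, hcons⟩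
  obtain ⟨s₀, hs₀⟩ := exists_fSeq_fdist ⟨_, _, hcons⟩
  obtain ⟨_, _, e, _, f, hf, rfl⟩ := hstruct _ _ hflip
  have hftar : f ∈ Gtar := by
    by_contra hftar
    have hsub : insert f (G₀.erase e) ∩ Gtar ⊆ G₀ ∩ Gtar := by
      rw [Finset.insert_inter_of_notMem hftar]
      exact Finset.inter_subset_inter_right (Finset.erase_subset e G₀)
    have := Finset.card_le_card hsub
    omega
  have hback := hhappy _ _ _ _ (hs₀.cons h₁ (hsymm _ _ hflip))
    ⟨0, Nat.succ_pos _, f, by simp [hftar], by simp, by simpa [hs₀.1] using hf⟩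
  omega

end FlipAbstract
end

section
/- Assume the perfect flip property holds: for all G_0, G_1, G_tar ∈ 𝒞 such that Flip G_0 G_1, |G_1 ∩ G_tar| = |G_0 ∩ G_tar| + 1, and some flip sequence from G_1 to G_tar exists, one has dist(G_0, G_tar) = dist(G_1, G_tar) + 1. Assume moreover that for every flip (Flip G H with H = (G \ {e_1}) ∪ {e_2}), no configuration in 𝒞 contains both e_1 and e_2. Then for all G_in, G_tar ∈ 𝒞, every flip sequence from G_in to G_tar that flips a happy edge has length at least dist(G_in, G_tar) + 2. -/
namespace FlipAbstract

theorem FSeq.suffix {E : Type*} {C : Set (Finset E)} {Flip : Finset E → Finset E → Prop}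
    {seq : ℕ → Finset E} {k : ℕ} {G H : Finset E} (h : FSeq C Flip seq k G H)
    {i : ℕ} (hi : i ≤ k) : FSeq C Flip (fun j => seq (i + j)) (k - i) (seq i) H := by
  obtain ⟨-, hk, hC, hF⟩ := h
  refine ⟨rfl, ?_, fun j hj => hC _ (by omega), fun j hj => hF (i + j) (by omega)⟩
  simpa [Nat.add_sub_cancel' hi] using hk

theorem FSeq.fdist_le {E : Type*} {C : Set (Finset E)} {Flip : Finset E → Finset E → Prop}
    {seq : ℕ → Finset E} {k : ℕ} {G H : Finset E} (h : FSeq C Flip seq k G H) :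
    fdist C Flip G H ≤ k :=
  Nat.sInf_le ⟨seq, h⟩

/-- Following the first `i` flips of a flip sequence and then a shortest one to the end. -/
theorem FSeq.fdist_le_add {E : Type*} {C : Set (Finset E)}
    {Flip : Finset E → Finset E → Prop} {seq : ℕ → Finset E} {k : ℕ} {G H : Finset E}
    (h : FSeq C Flip seq k G H) {i : ℕ} (hi : i ≤ k) :
    fdist C Flip G H ≤ i + fdist C Flip (seq i) H := by
  obtain ⟨t, ht0, htk, htC, htF⟩ :
      ∃ t, FSeq C Flip t (fdist C Flip (seq i) H) (seq i) H :=
    Nat.sInf_mem (s := {m | ∃ t, FSeq C Flip t m (seq i) H}) ⟨_, _, h.suffix hi⟩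
  obtain ⟨h0, -, hC, hF⟩ := h
  refine FSeq.fdist_le (seq := fun j => if j ≤ i then seq j else t (j - i)) ⟨?_, ?_, ?_, ?_⟩
  · simpa using h0
  · by_cases hd : fdist C Flip (seq i) H = 0
    · rw [hd] at htk
      simpa [hd] using ht0.symm.trans htk
    · simpa [hd] using htk
  · intro j hj
    dsimp only
    split_ifs with hji
    · exact hC j (by omega)
    · exact htC _ (by omega)
  · intro j hj
    rcases lt_trichotomy j i with hji | rfl | hji
    · simpa [hji.le, Nat.succ_le_of_lt hji] using hF j (by omega)
    · simpa [ht0] using htF 0 (by omega)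
    · have := htF (j - i) (by omega)
      rw [← Nat.sub_add_comm hji.le] at this
      simpa [hji.not_ge, show ¬ j + 1 ≤ i by omega] using this

/-- If the perfect flip property holds, and moreover for every flip the removed
edge `e₁` and the added edge `e₂` can never be contained in one configuration,
then every flip sequence that flips a happy edge has length at least
`dist + 2`. -/
theorem statement_10 {E : Type*} [DecidableEq E]
    (C : Set (Finset E)) (Flip : Finset E → Finset E → Prop)
    (hsymm : ∀ G H, Flip G H → Flip H G)
    (hstruct : ∀ G H, Flip G H →
      G ∈ C ∧ H ∈ C ∧ ∃ e ∈ G, ∃ f, f ∉ G ∧ H = insert f (G.erase e))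
    (hperfect : ∀ G₀ G₁ Gtar : Finset E, G₀ ∈ C → G₁ ∈ C → Gtar ∈ C →
      Flip G₀ G₁ → (G₁ ∩ Gtar).card = (G₀ ∩ Gtar).card + 1 →
      (∃ seq k, FSeq C Flip seq k G₁ Gtar) →
      fdist C Flip G₀ Gtar = fdist C Flip G₁ Gtar + 1)
    (hnoco : ∀ (G H : Finset E) (e₁ e₂ : E), Flip G H → e₁ ∈ G → e₂ ∉ G →
      H = insert e₂ (G.erase e₁) → ∀ K ∈ C, ¬ (e₁ ∈ K ∧ e₂ ∈ K)) :
    ∀ (Gin Gtar : Finset E) (seq : ℕ → Finset E) (k : ℕ),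
      FSeq C Flip seq k Gin Gtar →
      (∃ i < k, ∃ e, e ∈ Gin ∩ Gtar ∧ e ∈ seq i ∧ e ∉ seq (i + 1)) →
      fdist C Flip Gin Gtar + 2 ≤ k := by
  intro Gin Gtar seq k hseq ⟨i, hik, e, he, hei, hei'⟩
  have hetar : e ∈ Gtar := (Finset.mem_inter.mp he).2
  have hflip := hseq.2.2.2 i hik
  obtain ⟨hG, hH, e', he', f, hf, hH_eq⟩ := hstruct _ _ hflip
  have htar : Gtar ∈ C := hseq.2.1 ▸ hseq.2.2.1 k le_rfl
  obtain rfl : e = e' := by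
    by_contra hne
    exact hei' (by simp [hH_eq, hne, hei])
  have hftar : f ∉ Gtar := fun hft => hnoco _ _ _ _ hflip hei hf hH_eq Gtar htar ⟨hetar, hft⟩
  have hcard : (seq i ∩ Gtar).card = (seq (i + 1) ∩ Gtar).card + 1 := by
    rw [hH_eq, Finset.insert_inter_of_notMem hftar, Finset.erase_inter,
      Finset.card_erase_add_one (Finset.mem_inter.mpr ⟨hei, hetar⟩)]
  have hdist := hperfect _ _ _ hH hG htar (hsymm _ _ hflip) hcard ⟨_, _, hseq.suffix hik.le⟩
  have hsuffix := (hseq.suffix (Nat.succ_le_of_lt hik)).fdist_le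
  have hprefix := hseq.fdist_le_add hik.le
  simp only [Nat.succ_eq_add_one] at hsuffix
  omega

end FlipAbstract
end
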